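/- If a_1 = 0 and K has characteristic not two, then the Hilbert function of M is symmetric: h_M(t) = h_M(d − 3 − t) for all t, where d = Σ_{j=1}^{n+2} b_j − Σ_{i=1}^n a_i. -/

import Mathlib

open MvPolynomial

noncomputable section

/-- The height (codimension) of an ideal: the infimum of the heights of the
prime ideals containing it. -/
def idealHeight {R : Type*} [CommRing R] (I : Ideal R) : ℕ∞ :=
  ⨅ (p : PrimeSpectrum R) (_ : I ≤ p.asIdeal), Order.height p

/-- The degree-`z` homogeneous component of `K[x₁, …, x_r]`, for `z : ℤ`
(it is zero in negative degrees). -/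
def hcomp (K : Type*) [Field K] (r : ℕ) (z : ℤ) : Submodule K (MvPolynomial (Fin r) K) :=
  if 0 ≤ z then homogeneousSubmodule (Fin r) K z.toNat else ⊥

/-- The degree-`t` graded piece of the cokernel `M` of the graded map
`φ : ⊕_j R(-b j) → ⊕_i R(-a i)`. -/
def cokerPiece {K : Type*} [Field K] {n m : ℕ}
    (φ : Matrix (Fin n) (Fin m) (MvPolynomial (Fin 3) K)) (a : Fin n → ℤ) (t : ℤ) :
    Submodule K ((Fin n → MvPolynomial (Fin 3) K) ⧸ LinearMap.range φ.mulVecLin) :=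
  (Submodule.pi Set.univ fun i => hcomp K 3 (t - a i)).map
    ((LinearMap.range φ.mulVecLin).mkQ.restrictScalars K)

end

section GradedPieces

variable {K : Type*} [Field K] {r : ℕ}

theorem mem_hcomp_iff {z : ℤ} {p : MvPolynomial (Fin r) K} :
    p ∈ hcomp K r z ↔ p = 0 ∨ (0 ≤ z ∧ p.IsHomogeneous z.toNat) := by
  unfold hcomp
  split_ifs with h
  · simp only [mem_homogeneousSubmodule, h, true_and]
    exact ⟨Or.inr, fun H => H.elim (fun h0 => h0 ▸ isHomogeneous_zero _ _ _) id⟩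
  · simp [h]

theorem mul_mem_hcomp {u v : ℤ} {p q : MvPolynomial (Fin r) K}
    (hp : p ∈ hcomp K r u) (hq : q ∈ hcomp K r v) : p * q ∈ hcomp K r (u + v) := by
  rw [mem_hcomp_iff] at *
  rcases hp with rfl | ⟨hu, hp⟩
  · simp
  rcases hq with rfl | ⟨hv, hq⟩
  · simp
  right
  refine ⟨by positivity, ?_⟩
  rw [Int.toNat_add hu hv]
  exact hp.mul hq

theorem one_mem_hcomp : (1 : MvPolynomial (Fin r) K) ∈ hcomp K r 0 :=
  mem_hcomp_iff.2 (Or.inr ⟨le_rfl, isHomogeneous_one _ _⟩)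

theorem prod_mem_hcomp {ι : Type*} (s : Finset ι) (f : ι → MvPolynomial (Fin r) K) (c : ι → ℤ)
    (h : ∀ i ∈ s, f i ∈ hcomp K r (c i)) : ∏ i ∈ s, f i ∈ hcomp K r (∑ i ∈ s, c i) := by
  classical
  induction s using Finset.induction_on with
  | empty => simpa using one_mem_hcomp
  | insert a s ha ih =>
    rw [Finset.prod_insert ha, Finset.sum_insert ha]
    exact mul_mem_hcomp (h a (by simp)) (ih fun i hi => h i (by simp [hi]))

/-- A square matrix whose entries are homogeneous of degree `c j - d i` has homogeneous
determinant. -/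
theorem det_mem_hcomp {ι : Type*} [Fintype ι] [DecidableEq ι]
    (A : Matrix ι ι (MvPolynomial (Fin r) K)) (c d : ι → ℤ)
    (h : ∀ i j, A i j ∈ hcomp K r (c j - d i)) :
    A.det ∈ hcomp K r (∑ i, c i - ∑ i, d i) := by
  rw [Matrix.det_apply]
  refine Submodule.sum_mem _ fun σ _ => ?_
  have := prod_mem_hcomp Finset.univ (fun i => A (σ i) i) (fun i => c i - d (σ i))
    fun i _ => h _ _
  rw [Finset.sum_sub_distrib, Equiv.sum_comp σ d] at this
  rcases Int.units_eq_one_or (Equiv.Perm.sign σ) with hs | hs <;> simpa [hs] using this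

/-- Projection of a polynomial onto its homogeneous component of integer degree `z`. -/
noncomputable def hproj (K : Type*) [Field K] (r : ℕ) (z : ℤ) :
    MvPolynomial (Fin r) K →ₗ[K] MvPolynomial (Fin r) K :=
  if 0 ≤ z then homogeneousComponent z.toNat else 0

theorem hproj_mem (z : ℤ) (p : MvPolynomial (Fin r) K) : hproj K r z p ∈ hcomp K r z := by
  unfold hproj hcomp
  split_ifs
  · exact homogeneousComponent_mem _ _
  · simp

theorem hproj_of_mem {z v : ℤ} {p : MvPolynomial (Fin r) K} (hp : p ∈ hcomp K r v) :
    hproj K r z p = if z = v then p else 0 := by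
  rcases mem_hcomp_iff.1 hp with rfl | ⟨hv, hp⟩
  · simp
  unfold hproj
  by_cases hz : 0 ≤ z
  · rw [if_pos hz, homogeneousComponent_of_mem hp]
    congr 1
    apply propext
    lia
  · rw [if_neg hz, if_neg (by lia)]
    rfl

theorem hproj_mul {u : ℤ} {p : MvPolynomial (Fin r) K} (hp : p ∈ hcomp K r u) (z : ℤ)
    (q : MvPolynomial (Fin r) K) : hproj K r z (p * q) = p * hproj K r (z - u) q := by
  have key : ∀ v : ℤ, ∀ q ∈ hcomp K r v, hproj K r z (p * q) = p * hproj K r (z - u) q := by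
    intro v q hq
    rw [hproj_of_mem (mul_mem_hcomp hp hq), hproj_of_mem hq]
    by_cases h : z = u + v
    · rw [if_pos h, if_pos (by lia)]
    · rw [if_neg h, if_neg (by lia), mul_zero]
  rw [← sum_homogeneousComponent q, Finset.mul_sum, map_sum, map_sum, Finset.mul_sum]
  refine Finset.sum_congr rfl fun i _ => key i _ ?_
  exact mem_hcomp_iff.2 (Or.inr ⟨by positivity, homogeneousComponent_isHomogeneous _ _⟩)

instance (z : ℤ) : FiniteDimensional K (hcomp K r z) := by
  by_cases h : 0 ≤ z
  · rw [hcomp, if_pos h]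
    exact Module.Finite.iff_fg.2 (homogeneousSubmodule_fg _ _ _)
  · rw [hcomp, if_neg h]
    infer_instance

theorem finrank_homogeneousSubmodule (m : ℕ) :
    Module.finrank K (homogeneousSubmodule (Fin r) K m) = (r + m - 1).choose m := by
  classical
  have e : {d : Fin r →₀ ℕ | d.degree = m} =
      (Finset.finsuppAntidiag (Finset.univ : Finset (Fin r)) m : Set (Fin r →₀ ℕ)) := by
    ext d
    simp [Finset.mem_finsuppAntidiag, Finsupp.degree_eq_sum]
  rw [homogeneousSubmodule_eq_finsupp_supported, e]
  have := (AddMonoidAlgebra.supportedEquivFinsupp (R := K) (S := K)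
    (↑(Finset.finsuppAntidiag (Finset.univ : Finset (Fin r)) m) : Set (Fin r →₀ ℕ))).finrank_eq
  rw [this]
  simp [Finset.card_finsuppAntidiag_nat_eq_choose]

/-- Duality for the Hilbert function of the polynomial ring in three variables. -/
theorem finrank_hcomp_add (s : ℤ) :
    2 * ((Module.finrank K (hcomp K 3 s) : ℤ) + Module.finrank K (hcomp K 3 (-3 - s)))
      = (s + 1) * (s + 2) := by
  have pos : ∀ s : ℤ, 0 ≤ s → 2 * (Module.finrank K (hcomp K 3 s) : ℤ) = (s + 1) * (s + 2) := by
    intro s hs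
    lift s to ℕ using hs
    have h : (hcomp K 3 s) = homogeneousSubmodule (Fin 3) K s := by simp [hcomp]
    have h2 : (3 + s - 1).choose s = (s + 2).choose 2 := by
      rw [show 3 + s - 1 = s + 2 by lia, Nat.choose_symm_add]
    rw [h, finrank_homogeneousSubmodule, h2]
    have h3 := Nat.choose_two_right (s + 2)
    have h4 : 2 ∣ (s + 2) * (s + 2 - 1) := (Nat.even_mul_pred_self _).two_dvd
    have h5 : 2 * (s + 2).choose 2 = (s + 2) * (s + 1) := by
      rw [h3, Nat.mul_div_cancel' h4]; rfl
    have h6 : (2 : ℤ) * ((s + 2).choose 2 : ℤ) = (s + 2) * (s + 1) := by exact_mod_cast h5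
    rw [h6]; ring
  have neg : ∀ s : ℤ, s < 0 → (Module.finrank K (hcomp K 3 s) : ℤ) = 0 := by
    intro s hs
    have h : (hcomp K 3 s) = ⊥ := by simp [hcomp, hs]
    rw [h]; simp
  rcases lt_or_ge s 0 with h | h
  · rcases lt_or_ge (-3 - s) 0 with h' | h'
    · rw [neg _ h, neg _ h']
      obtain rfl | rfl : s = -1 ∨ s = -2 := by lia
      all_goals norm_num
    · rw [neg _ h, zero_add, pos _ h']; ring
  · rw [neg (-3 - s) (by lia), add_zero, pos _ h]

/-- The degree-`t` piece of the graded free module `⊕ᵢ R(-cᵢ)`. -/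
noncomputable def freePiece (K : Type*) [Field K] {ι : Type*} (c : ι → ℤ) (t : ℤ) :
    Submodule K (ι → MvPolynomial (Fin 3) K) :=
  Submodule.pi Set.univ fun i => hcomp K 3 (t - c i)

theorem mem_freePiece {ι : Type*} {c : ι → ℤ} {t : ℤ} {v : ι → MvPolynomial (Fin 3) K} :
    v ∈ freePiece K c t ↔ ∀ i, v i ∈ hcomp K 3 (t - c i) := by
  simp [freePiece]

variable {ι κ : Type*}

theorem freePiece_eq_range (c : ι → ℤ) (t : ℤ) : freePiece K c t = LinearMap.range
    (LinearMap.piMap fun i => (hcomp K 3 (t - c i)).subtype) := by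
  ext v
  rw [mem_freePiece]
  constructor
  · intro h
    exact ⟨fun i => ⟨v i, h i⟩, rfl⟩
  · rintro ⟨w, rfl⟩ i
    exact (w i).2

variable [Fintype κ]

instance [Fintype ι] (c : ι → ℤ) (t : ℤ) : FiniteDimensional K (freePiece K c t) := by
  rw [freePiece_eq_range]
  infer_instance

theorem finrank_freePiece [Fintype ι] (c : ι → ℤ) (t : ℤ) :
    Module.finrank K (freePiece K c t) = ∑ i, Module.finrank K (hcomp K 3 (t - c i)) := by
  rw [freePiece_eq_range, LinearMap.finrank_range_of_inj, Module.finrank_pi_fintype]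
  intro v w h
  ext1 i
  exact Subtype.ext (congrFun h i)

/-- A homogeneous element in the range of a homogeneous matrix is the image of a homogeneous
element. -/
theorem freePiece_inf_range (A : Matrix ι κ (MvPolynomial (Fin 3) K)) (c : ι → ℤ) (d : κ → ℤ)
    (hA : ∀ i j, A i j ∈ hcomp K 3 (d j - c i)) (t : ℤ) :
    freePiece K c t ⊓ (LinearMap.range A.mulVecLin).restrictScalars K
      = (freePiece K d t).map (A.mulVecLin.restrictScalars K) := by
  ext v
  constructor
  · rintro ⟨hv, w, rfl⟩
    refine ⟨fun j => hproj K 3 (t - d j) (w j), mem_freePiece.2 fun j => hproj_mem _ _, ?_⟩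
    ext1 i
    have h := mem_freePiece.1 hv i
    have h2 := hproj_of_mem (z := t - c i) h
    rw [if_pos rfl] at h2
    rw [← h2]
    simp only [LinearMap.coe_restrictScalars, Matrix.mulVecLin_apply, Matrix.mulVec, dotProduct,
      map_sum]
    refine Finset.sum_congr rfl fun j _ => ?_
    rw [hproj_mul (hA i j)]
    congr 2
    ring_nf
  · rintro ⟨w, hw, rfl⟩
    refine ⟨mem_freePiece.2 fun i => ?_, w, rfl⟩
    refine Submodule.sum_mem _ fun j _ => ?_
    have := mul_mem_hcomp (hA i j) (mem_freePiece.1 hw j)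
    rwa [show d j - c i + (t - d j) = t - c i by ring] at this

theorem finrank_map_add_finrank_inf_ker {V W : Type*} [AddCommGroup V] [Module K V]
    [AddCommGroup W] [Module K W] (f : V →ₗ[K] W) (p : Submodule K V) [FiniteDimensional K p] :
    Module.finrank K (p.map f) + Module.finrank K ↥(p ⊓ LinearMap.ker f)
      = Module.finrank K p := by
  rw [← (f.domRestrict p).finrank_range_add_finrank_ker, LinearMap.range_domRestrict,
    LinearMap.ker_domRestrict, inf_comm]
  congr 1
  exact (Submodule.finrank_map_subtype_eq p _).symm.trans
    (by rw [Submodule.map_comap_subtype, inf_comm]) |>.symm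

end GradedPieces
section Acyclicity

universe v

variable {R : Type*} [CommRing R]

/-- Peskine–Szpiro acyclicity for a complex of free modules of length three whose homology is
annihilated by each member of a regular sequence `f, g, h`. -/
theorem exact_of_smul_exact {ι κ κ' μ : Type v}
    (d₃ : (ι → R) →ₗ[R] (κ → R)) (d₂ : (κ → R) →ₗ[R] (κ' → R)) (d₁ : (κ' → R) →ₗ[R] (μ → R))
    (h₂₃ : ∀ v, d₂ (d₃ v) = 0)
    (f g h : R) (hf : ∀ a : R, f * a = 0 → a = 0)
    (hfg : ∀ a b : R, g * a = f * b → ∃ c, a = f * c)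
    (hfgh : ∀ w a b : R, h * w = f * a + g * b → ∃ c e, w = f * c + g * e)
    (ex₃ : ∀ s ∈ ({f, g, h} : Set R), ∀ v, d₃ v = 0 → s • v = 0)
    (ex₂ : ∀ s ∈ ({f, g, h} : Set R), ∀ v, d₂ v = 0 → ∃ w, d₃ w = s • v)
    (ex₁ : ∀ s ∈ ({f, g, h} : Set R), ∀ v, d₁ v = 0 → ∃ w, d₂ w = s • v) :
    (∀ v, d₃ v = 0 → v = 0) ∧ (∀ v, d₂ v = 0 → ∃ w, d₃ w = v) ∧
      (∀ v, d₁ v = 0 → ∃ w, d₂ w = v) := by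
  have hf' : ∀ {τ : Type v} (v : τ → R), f • v = 0 → v = 0 := fun v hv =>
    funext fun i => hf _ (congrFun hv i)
  have cancel : ∀ {τ : Type v} {v w : τ → R}, f • v = f • w → v = w := fun {τ v w} hv =>
    sub_eq_zero.1 (funext fun i => hf _ (by
      have := congrFun hv i
      simp only [Pi.smul_apply, smul_eq_mul] at this
      simp [mul_sub, this]))
  have hfg' : ∀ {τ : Type v} (v w : τ → R), g • v = f • w → ∃ c : τ → R, v = f • c := by
    intro τ v w hv
    choose c hc using fun i => hfg (v i) (w i) (congrFun hv i)
    exact ⟨c, funext hc⟩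
  have hfgh' : ∀ {τ : Type v} (w a b : τ → R), h • w = f • a + g • b →
      ∃ c e : τ → R, w = f • c + g • e := by
    intro τ w a b hv
    choose c e hc using fun i => hfgh (w i) (a i) (b i) (congrFun hv i)
    exact ⟨c, e, funext hc⟩
  have inj₃ : ∀ v, d₃ v = 0 → v = 0 := fun v hv => hf' v (ex₃ f (by simp) v hv)
  have inj₃' : ∀ v w, d₃ v = d₃ w → v = w := fun v w hv =>
    sub_eq_zero.1 (inj₃ _ (by rw [map_sub, hv, sub_self]))
  have exact₂ : ∀ v, d₂ v = 0 → ∃ w, d₃ w = v := by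
    intro u hu
    obtain ⟨v, hv⟩ := ex₂ f (by simp) u hu
    obtain ⟨w, hw⟩ := ex₂ g (by simp) u hu
    have : g • v = f • w := inj₃' _ _ (by rw [map_smul, map_smul, hv, hw, smul_comm])
    obtain ⟨c, rfl⟩ := hfg' _ _ this
    exact ⟨c, cancel (by rw [← map_smul, hv])⟩
  refine ⟨inj₃, exact₂, fun u hu => ?_⟩
  obtain ⟨vf, hvf⟩ := ex₁ f (by simp) u hu
  obtain ⟨vg, hvg⟩ := ex₁ g (by simp) u hu
  obtain ⟨vh, hvh⟩ := ex₁ h (by simp) u hu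
  obtain ⟨wfg, hfg₁⟩ := exact₂ (g • vf - f • vg) (by
    rw [map_sub, map_smul, map_smul, hvf, hvg, smul_comm, sub_self])
  obtain ⟨wfh, hfh₁⟩ := exact₂ (h • vf - f • vh) (by
    rw [map_sub, map_smul, map_smul, hvf, hvh, smul_comm, sub_self])
  obtain ⟨wgh, hgh₁⟩ := exact₂ (h • vg - g • vh) (by
    rw [map_sub, map_smul, map_smul, hvg, hvh, smul_comm, sub_self])
  obtain ⟨α, β, rfl⟩ := hfgh' wfg (-wgh) wfh (inj₃' _ _ (by
    simp only [map_add, map_smul, map_neg, hfg₁, hfh₁, hgh₁]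
    module))
  have hα : g • (vf - d₃ β) = f • (vg + d₃ α) := by
    rw [map_add, map_smul, map_smul] at hfg₁
    rw [smul_sub, smul_add, ← sub_eq_zero]
    rw [← sub_eq_zero] at hfg₁
    rw [← neg_eq_zero, ← hfg₁]
    module
  obtain ⟨c, hc⟩ := hfg' _ _ hα
  refine ⟨c, cancel ?_⟩
  rw [← map_smul, ← hc, map_sub, h₂₃, sub_zero, hvf]

end Acyclicity

section BuchsbaumRim

variable {R : Type*} {n : ℕ}

/-- The square matrix obtained from `φ` by adjoining the two rows `u` and `v`. -/
def adjoinRows (φ : Matrix (Fin n) (Fin (n + 2)) R) (u v : Fin (n + 2) → R) :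
    Matrix (Fin n ⊕ Fin 2) (Fin (n + 2)) R :=
  Matrix.of (Sum.elim φ ![u, v])

@[simp]
theorem adjoinRows_inl (φ : Matrix (Fin n) (Fin (n + 2)) R) (u v : Fin (n + 2) → R) (i : Fin n) :
    adjoinRows φ u v (Sum.inl i) = φ i := rfl

@[simp]
theorem adjoinRows_inr_zero (φ : Matrix (Fin n) (Fin (n + 2)) R) (u v : Fin (n + 2) → R) :
    adjoinRows φ u v (Sum.inr 0) = u := rfl

@[simp]
theorem adjoinRows_inr_one (φ : Matrix (Fin n) (Fin (n + 2)) R) (u v : Fin (n + 2) → R) :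
    adjoinRows φ u v (Sum.inr 1) = v := rfl

variable [CommRing R]

/-- The alternating form sending `u, v` to the determinant of `φ` with rows `u, v` adjoined. -/
def minorForm (φ : Matrix (Fin n) (Fin (n + 2)) R) (u v : Fin (n + 2) → R) : R :=
  ((adjoinRows φ u v).submatrix id finSumFinEquiv).det

/-- The middle map of the Buchsbaum–Rim complex: the skew matrix of complementary minors. -/
def minorMatrix (φ : Matrix (Fin n) (Fin (n + 2)) R) : Matrix (Fin (n + 2)) (Fin (n + 2)) R :=
  Matrix.of fun j k => minorForm φ (Pi.single j 1) (Pi.single k 1)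

variable (φ : Matrix (Fin n) (Fin (n + 2)) R)

theorem exists_linearMap_minorForm (u : Fin (n + 2) → R) :
    ∃ L : (Fin (n + 2) → R) →ₗ[R] R, ∀ v, L v = minorForm φ u v := by
  refine ⟨(Matrix.detRowAlternating.toMultilinearMap.toLinearMap
    ((adjoinRows φ u 0).submatrix id finSumFinEquiv) (Sum.inr 1)).comp
      (LinearMap.funLeft R R finSumFinEquiv), fun v => ?_⟩
  change Matrix.det _ = Matrix.det _
  congr 1
  ext i j
  rcases i with i | i
  · rfl
  · fin_cases i <;> rfl

theorem minorForm_self (u : Fin (n + 2) → R) : minorForm φ u u = 0 :=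
  Matrix.det_zero_of_row_eq (i := Sum.inr 0) (j := Sum.inr 1) (by simp) rfl

theorem minorForm_row (u : Fin (n + 2) → R) (i : Fin n) : minorForm φ u (φ i) = 0 :=
  Matrix.det_zero_of_row_eq (i := Sum.inl i) (j := Sum.inr 1) (by simp) rfl

theorem minorForm_swap (u v : Fin (n + 2) → R) : minorForm φ v u = - minorForm φ u v := by
  have := Matrix.det_permute (Equiv.swap (Sum.inr 0) (Sum.inr 1))
    ((adjoinRows φ u v).submatrix id finSumFinEquiv)
  rw [Equiv.Perm.sign_swap (by simp)] at this
  rw [minorForm, minorForm]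
  simp only [Units.val_neg, Units.val_one, Int.cast_neg, Int.cast_one, neg_mul, one_mul] at this
  rw [← this]
  congr 1
  ext i j
  rcases i with i | i
  · rw [Matrix.submatrix_apply, Matrix.submatrix_apply,
      Equiv.swap_apply_of_ne_of_ne (by simp) (by simp)]
    rfl
  · fin_cases i
    · simp
    · simp

theorem minorMatrix_transpose : (minorMatrix φ).transpose = -minorMatrix φ := by
  ext j k
  exact minorForm_swap _ _ _

theorem minorMatrix_mul_transpose : minorMatrix φ * φ.transpose = 0 := by
  ext j i
  obtain ⟨L, hL⟩ := exists_linearMap_minorForm φ (Pi.single j 1)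
  have h := minorForm_row φ (Pi.single j 1) i
  rw [← hL, LinearMap.pi_apply_eq_sum_univ L] at h
  rw [Matrix.mul_apply, Matrix.zero_apply, ← h]
  refine Finset.sum_congr rfl fun k _ => ?_
  rw [smul_eq_mul, mul_comm, Matrix.transpose_apply, minorMatrix, Matrix.of_apply, ← hL]
  congr 2
  ext l
  simp [Pi.single_apply, eq_comm]

theorem mul_minorMatrix : φ * minorMatrix φ = 0 := by
  have := congrArg Matrix.transpose (minorMatrix_mul_transpose φ)
  rw [Matrix.transpose_mul, minorMatrix_transpose, Matrix.transpose_transpose, Matrix.mul_neg,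
    Matrix.transpose_zero, neg_eq_zero] at this
  exact this

theorem minorMatrix_diag (j : Fin (n + 2)) : minorMatrix φ j j = 0 := minorForm_self _ _

/-- The entries of `minorMatrix φ` are, up to sign, the complementary maximal minors of `φ`. -/
theorem exists_sign_minorMatrix (e : Fin n ⊕ Fin 2 ≃ Fin (n + 2)) : ∃ ε : R, ε * ε = 1 ∧
    minorMatrix φ (e (Sum.inr 0)) (e (Sum.inr 1))
      = ε * (φ.submatrix id (e ∘ Sum.inl)).det := by
  set B := adjoinRows φ (Pi.single (e (Sum.inr 0)) 1) (Pi.single (e (Sum.inr 1)) 1)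
  have h1 : (B.submatrix id e).det = (φ.submatrix id (e ∘ Sum.inl)).det := by
    have : B.submatrix id e = Matrix.fromBlocks (φ.submatrix id (e ∘ Sum.inl))
        (φ.submatrix id (e ∘ Sum.inr)) 0 1 := by
      ext i j
      rcases i with i | i
      · rcases j with j | j <;> rfl
      · rcases j with j | j
        · fin_cases i <;> simp [B]
        · fin_cases i <;> fin_cases j <;> simp [B]
    rw [this, Matrix.det_fromBlocks_zero₂₁, Matrix.det_one, mul_one]
  have h2 := Matrix.det_permute' (finSumFinEquiv.trans e.symm) (B.submatrix id e)
  rw [h1, Matrix.submatrix_submatrix] at h2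
  refine ⟨((Equiv.Perm.sign (finSumFinEquiv.trans e.symm) : ℤ) : R), ?_, Eq.trans ?_ h2⟩
  · rw [← Int.cast_mul, ← Units.val_mul, Int.units_mul_self]
    simp
  · change Matrix.det _ = Matrix.det _
    congr 1
    ext i j
    simp [B]

section Annihilation

variable (e : Fin n ⊕ Fin 2 ≃ Fin (n + 2))

theorem minor_smul_eq_zero (v : Fin n → R) (hv : φ.transpose.mulVec v = 0) :
    (φ.submatrix id (e ∘ Sum.inl)).det • v = 0 := by
  set A := φ.submatrix id (e ∘ Sum.inl)
  have h : A.transpose.mulVec v = 0 := funext fun i => congrFun hv (e (Sum.inl i))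
  have h2 := congrArg A.transpose.adjugate.mulVec h
  rw [Matrix.mulVec_mulVec, Matrix.adjugate_mul, Matrix.mulVec_zero, Matrix.smul_mulVec,
    Matrix.one_mulVec, Matrix.det_transpose] at h2
  exact h2

theorem sum_equiv_eq (f : Fin (n + 2) → R) :
    ∑ k, f k = ∑ i, f (e (Sum.inl i)) + (f (e (Sum.inr 0)) + f (e (Sum.inr 1))) := by
  rw [← e.sum_comp, Fintype.sum_sum_type, Fin.sum_univ_two]

variable [IsDomain R]

theorem exists_transpose_mulVec_eq_minor_smul (u : Fin (n + 2) → R)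
    (hu : (minorMatrix φ).mulVec u = 0) :
    ∃ w, φ.transpose.mulVec w = (φ.submatrix id (e ∘ Sum.inl)).det • u := by
  set A := φ.submatrix id (e ∘ Sum.inl) with hA
  by_cases hδ : A.det = 0
  · exact ⟨0, by simp [hδ]⟩
  obtain ⟨ε, hε, hM⟩ := exists_sign_minorMatrix φ e
  rw [← hA] at hM
  have hM0 : minorMatrix φ (e (Sum.inr 0)) (e (Sum.inr 1)) ≠ 0 := by
    rw [hM]
    exact mul_ne_zero (left_ne_zero_of_mul_eq_one hε) hδ
  have hM' : minorMatrix φ (e (Sum.inr 1)) (e (Sum.inr 0)) ≠ 0 := by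
    have := congrFun (congrFun (minorMatrix_transpose φ) (e (Sum.inr 0))) (e (Sum.inr 1))
    rw [Matrix.transpose_apply] at this
    rw [this]
    exact neg_ne_zero.2 hM0
  set w := A.transpose.adjugate.mulVec (u ∘ e ∘ Sum.inl) with hw
  have h1 : ∀ i, φ.transpose.mulVec w (e (Sum.inl i)) = A.det * u (e (Sum.inl i)) := by
    have : A.transpose.mulVec w = A.det • (u ∘ e ∘ Sum.inl) := by
      rw [hw, Matrix.mulVec_mulVec, Matrix.mul_adjugate, Matrix.smul_mulVec,
        Matrix.one_mulVec, Matrix.det_transpose]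
    exact fun i => congrFun this i
  have h2 : (minorMatrix φ).mulVec (φ.transpose.mulVec w - A.det • u) = 0 := by
    rw [Matrix.mulVec_sub, Matrix.mulVec_mulVec, minorMatrix_mul_transpose, Matrix.mulVec_smul, hu]
    simp
  set z := φ.transpose.mulVec w - A.det • u
  have hz : ∀ i, z (e (Sum.inl i)) = 0 := fun i => by simp [z, h1]
  have hp := congrFun h2 (e (Sum.inr 0))
  have hq := congrFun h2 (e (Sum.inr 1))
  rw [Matrix.mulVec, dotProduct, sum_equiv_eq e] at hp hq
  simp only [hz, mul_zero, Finset.sum_const_zero, minorMatrix_diag, zero_mul, zero_add, add_zero,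
    Pi.zero_apply, mul_eq_zero, hM0, hM', false_or] at hp hq
  refine ⟨w, sub_eq_zero.1 (funext fun k => ?_)⟩
  obtain ⟨i | i, rfl⟩ := e.surjective k
  · exact hz i
  · fin_cases i
    · exact hq
    · exact hp

theorem exists_minorMatrix_mulVec_eq_minor_smul (u : Fin (n + 2) → R) (hu : φ.mulVec u = 0) :
    ∃ w, (minorMatrix φ).mulVec w = (φ.submatrix id (e ∘ Sum.inl)).det • u := by
  set A := φ.submatrix id (e ∘ Sum.inl) with hA
  by_cases hδ : A.det = 0
  · exact ⟨0, by simp [hδ]⟩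
  obtain ⟨ε, hε, hM⟩ := exists_sign_minorMatrix φ e
  rw [← hA] at hM
  have hM' : minorMatrix φ (e (Sum.inr 1)) (e (Sum.inr 0)) = -(ε * A.det) := by
    have := congrFun (congrFun (minorMatrix_transpose φ) (e (Sum.inr 0))) (e (Sum.inr 1))
    rw [Matrix.transpose_apply] at this
    rw [this, ← hM]
    rfl
  set w : Fin (n + 2) → R :=
    Sum.elim 0 ![-(ε * u (e (Sum.inr 1))), ε * u (e (Sum.inr 0))] ∘ e.symm with hw
  have h2 : φ.mulVec ((minorMatrix φ).mulVec w - A.det • u) = 0 := by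
    rw [Matrix.mulVec_sub, Matrix.mulVec_mulVec, mul_minorMatrix, Matrix.mulVec_smul, hu]
    simp
  set z := (minorMatrix φ).mulVec w - A.det • u with hz
  have hp : z (e (Sum.inr 0)) = 0 := by
    rw [hz, Pi.sub_apply, Matrix.mulVec, dotProduct, sum_equiv_eq e]
    simp only [hw, Function.comp_apply, Equiv.symm_apply_apply, Sum.elim_inl, Sum.elim_inr,
      minorMatrix_diag, hM, Pi.zero_apply, mul_zero, Finset.sum_const_zero, Pi.smul_apply,
      smul_eq_mul, Matrix.cons_val_zero, Matrix.cons_val_one]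
    linear_combination A.det * u (e (Sum.inr 0)) * hε
  have hq : z (e (Sum.inr 1)) = 0 := by
    rw [hz, Pi.sub_apply, Matrix.mulVec, dotProduct, sum_equiv_eq e]
    simp only [hw, Function.comp_apply, Equiv.symm_apply_apply, Sum.elim_inl, Sum.elim_inr,
      minorMatrix_diag, hM', Pi.zero_apply, mul_zero, Finset.sum_const_zero, Pi.smul_apply,
      smul_eq_mul, Matrix.cons_val_zero, Matrix.cons_val_one]
    linear_combination A.det * u (e (Sum.inr 1)) * hε
  have h3 : A.mulVec (z ∘ e ∘ Sum.inl) = 0 := by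
    ext i
    have := congrFun h2 i
    rw [Matrix.mulVec, dotProduct, sum_equiv_eq e, hp, hq, mul_zero, mul_zero, add_zero,
      add_zero] at this
    exact this
  have h4 := Matrix.eq_zero_of_mulVec_eq_zero hδ h3
  refine ⟨w, sub_eq_zero.1 (funext fun k => ?_)⟩
  obtain ⟨i | i, rfl⟩ := e.surjective k
  · exact congrFun h4 i
  · fin_cases i
    · exact hp
    · exact hq

end Annihilation

theorem exists_equiv_comp_inl_eq (g : Fin n → Fin (n + 2)) (hg : Function.Injective g) :
    ∃ e : Fin n ⊕ Fin 2 ≃ Fin (n + 2), e ∘ Sum.inl = g := by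
  classical
  have hc : Fintype.card ↑(Set.range g)ᶜ = 2 := by
    rw [Fintype.card_compl_set, Set.card_range_of_injective hg]
    simp
  refine ⟨(Equiv.sumCongr (Equiv.ofInjective g hg) (Fintype.equivFinOfCardEq hc).symm).trans
    (Equiv.Set.sumCompl (Set.range g)), ?_⟩
  ext i
  simp

/-- The homology of the Buchsbaum–Rim complex is annihilated by the ideal of maximal minors. -/
theorem minorIdeal_annihilates [IsDomain R] (s : R)
    (hs : s ∈ Ideal.span {m | ∃ g : Fin n → Fin (n + 2),
        Function.Injective g ∧ m = (φ.submatrix id g).det}) :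
    (∀ v, φ.transpose.mulVec v = 0 → s • v = 0) ∧
    (∀ v, (minorMatrix φ).mulVec v = 0 → ∃ w, φ.transpose.mulVec w = s • v) ∧
    (∀ v, φ.mulVec v = 0 → ∃ w, (minorMatrix φ).mulVec w = s • v) := by
  induction hs using Submodule.span_induction with
  | mem x hx =>
    obtain ⟨g, hg, rfl⟩ := hx
    obtain ⟨e, rfl⟩ := exists_equiv_comp_inl_eq g hg
    exact ⟨minor_smul_eq_zero φ e, exists_transpose_mulVec_eq_minor_smul φ e,
      exists_minorMatrix_mulVec_eq_minor_smul φ e⟩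
  | zero => exact ⟨by simp, fun v _ => ⟨0, by simp⟩, fun v _ => ⟨0, by simp⟩⟩
  | add x y _ _ hx hy =>
    refine ⟨fun v hv => by rw [add_smul, hx.1 v hv, hy.1 v hv, add_zero], fun v hv => ?_,
      fun v hv => ?_⟩
    · obtain ⟨w, hw⟩ := hx.2.1 v hv
      obtain ⟨w', hw'⟩ := hy.2.1 v hv
      exact ⟨w + w', by rw [Matrix.mulVec_add, hw, hw', add_smul]⟩
    · obtain ⟨w, hw⟩ := hx.2.2 v hv
      obtain ⟨w', hw'⟩ := hy.2.2 v hv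
      exact ⟨w + w', by rw [Matrix.mulVec_add, hw, hw', add_smul]⟩
  | smul c x _ hx =>
    refine ⟨fun v hv => by rw [smul_assoc, hx.1 v hv, smul_zero], fun v hv => ?_, fun v hv => ?_⟩
    · obtain ⟨w, hw⟩ := hx.2.1 v hv
      exact ⟨c • w, by rw [Matrix.mulVec_smul, hw, smul_assoc]⟩
    · obtain ⟨w, hw⟩ := hx.2.2 v hv
      exact ⟨c • w, by rw [Matrix.mulVec_smul, hw, smul_assoc]⟩

end BuchsbaumRim
section Height

variable {K : Type*} [Field K]

/-- The ideal of a line through the origin. -/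
theorem ker_line_lt_ker_eval {p : Fin 3 → K} (hp : p ≠ 0) :
    RingHom.ker (aeval fun i => Polynomial.C (p i) * Polynomial.X :
        MvPolynomial (Fin 3) K →ₐ[K] Polynomial K)
      < RingHom.ker (aeval p : MvPolynomial (Fin 3) K →ₐ[K] K) := by
  have h_eval : ∀ f : MvPolynomial (Fin 3) K,
      (aeval (fun i => Polynomial.C (p i) * Polynomial.X) f : Polynomial K).eval 1
        = aeval p f := by
    intro f
    induction f using MvPolynomial.induction_on with
    | C a => simp
    | add f g hf hg => simp [hf, hg]
    | mul_X f i hf => simp [hf]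
  rw [SetLike.lt_iff_le_and_exists]
  refine ⟨fun f hf => ?_, ?_⟩
  · rw [RingHom.mem_ker] at hf ⊢
    rw [← h_eval]
    change aeval _ f = (0 : Polynomial K) at hf
    rw [hf, Polynomial.eval_zero]
  · obtain ⟨i, hi⟩ := Function.ne_iff.1 hp
    refine ⟨X i - C (p i), by simp [RingHom.mem_ker], ?_⟩
    rw [RingHom.mem_ker]
    intro h
    have := congrArg (Polynomial.eval 0) h
    simp at this
    exact hi this

theorem aeval_line_of_isHomogeneous {p : Fin 3 → K} {f : MvPolynomial (Fin 3) K} {m : ℕ}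
    (hf : f.IsHomogeneous m) :
    (aeval (fun i => Polynomial.C (p i) * Polynomial.X) f : Polynomial K)
      = Polynomial.C (aeval p f) * Polynomial.X ^ m := by
  rw [aeval_def, aeval_def, eval₂_eq, eval₂_eq, map_sum, Finset.sum_mul]
  refine Finset.sum_congr rfl fun d hd => ?_
  have hdeg : ∑ i ∈ d.support, d i = m := by
    have := hf (mem_support_iff.1 hd)
    rwa [show (1 : Fin 3 → ℕ) = fun _ => 1 from rfl, ← Finsupp.degree_eq_weight_one] at this
  simp only [mul_pow, Finset.prod_mul_distrib, Finset.prod_pow_eq_pow_sum, hdeg]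
  simp [mul_assoc]

theorem exists_X_pow_mem [IsAlgClosed K] (S : Set (MvPolynomial (Fin 3) K))
    (hS : ∀ f ∈ S, ∃ z, f ∈ hcomp K 3 z) (hht : idealHeight (Ideal.span S) = 3) :
    ∃ N, ∀ i, (X i : MvPolynomial (Fin 3) K) ^ N ∈ Ideal.span S := by
  have hzero : ∀ p ∈ zeroLocus K (Ideal.span S), p = 0 := by
    intro p hp
    by_contra hp0
    have hlt := ker_line_lt_ker_eval hp0
    set P : PrimeSpectrum (MvPolynomial (Fin 3) K) :=
      ⟨RingHom.ker (aeval fun i => Polynomial.C (p i) * Polynomial.X :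
        MvPolynomial (Fin 3) K →ₐ[K] Polynomial K), RingHom.ker_isPrime _⟩
    set Q : PrimeSpectrum (MvPolynomial (Fin 3) K) :=
      ⟨RingHom.ker (aeval p : MvPolynomial (Fin 3) K →ₐ[K] K), RingHom.ker_isPrime _⟩
    have hPQ : P < Q := hlt
    have hQ : Order.height Q ≤ 3 := by
      have h1 := Order.height_le_krullDim Q
      have h2 : Order.krullDim (PrimeSpectrum (MvPolynomial (Fin 3) K)) = 3 := by
        change ringKrullDim _ = _
        rw [MvPolynomial.ringKrullDim_of_isNoetherianRing, ringKrullDim_eq_zero_of_field]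
        simp
      rw [h2] at h1
      exact WithBot.coe_le_coe.1 h1
    have hle : Ideal.span S ≤ P.asIdeal := by
      rw [Ideal.span_le]
      intro f hf
      change aeval _ f = (0 : Polynomial K)
      obtain ⟨z, hz⟩ := hS f hf
      rcases mem_hcomp_iff.1 hz with rfl | ⟨-, hz⟩
      · simp
      · rw [aeval_line_of_isHomogeneous hz,
          show aeval p f = 0 from hp f (Ideal.subset_span hf)]
        simp
    have h3 : (3 : ℕ∞) ≤ Order.height P := hht ▸ iInf₂_le P hle
    have h4 : Order.height P < Order.height Q := Order.height_strictMono hPQ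
      (lt_of_le_of_lt ((Order.height_mono hPQ.le).trans hQ) (ENat.natCast_lt_top 3))
    exact absurd (h3.trans_lt h4) (not_lt.2 hQ)
  have hrad : ∀ i, ∃ N, (X i : MvPolynomial (Fin 3) K) ^ N ∈ Ideal.span S := by
    intro i
    have : (X i : MvPolynomial (Fin 3) K) ∈ (Ideal.span S).radical := by
      rw [← vanishingIdeal_zeroLocus_eq_radical (K := K)]
      intro p hp
      rw [hzero p hp]
      simp
    exact this
  choose N hN using hrad
  exact ⟨∑ i, N i, fun i => Ideal.mem_of_dvd _ (pow_dvd_pow _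
    (Finset.single_le_sum (fun _ _ => Nat.zero_le _) (Finset.mem_univ i))) (hN i)⟩

theorem X_pow_dvd_of_mul_eq (N : ℕ) (a b : MvPolynomial (Fin 3) K)
    (h : X 1 ^ N * a = X 0 ^ N * b) : ∃ c, a = X 0 ^ N * c := by
  have hp : Prime (X 0 : MvPolynomial (Fin 3) K) := X_prime
  refine hp.pow_dvd_of_dvd_mul_left N (fun hd => ?_) (Dvd.intro b h.symm)
  have := X_dvd_X.1 (hp.dvd_of_dvd_pow hd)
  simp at this

theorem mem_span_X_pow_of_mul (N : ℕ) (w a b : MvPolynomial (Fin 3) K)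
    (h : X 2 ^ N * w = X 0 ^ N * a + X 1 ^ N * b) :
    ∃ c e, w = X 0 ^ N * c + X 1 ^ N * e := by
  classical
  set s : Set (Fin 3 →₀ ℕ) := {Finsupp.single 0 N, Finsupp.single 1 N}
  have himg : (fun s => monomial s (1 : K)) '' s = {X 0 ^ N, X 1 ^ N} := by
    simp [s, Set.image_pair, X_pow_eq_monomial]
  have hmem : X 2 ^ N * w ∈ Ideal.span ((fun s => monomial s (1 : K)) '' s) := by
    rw [himg, Ideal.mem_span_pair]
    exact ⟨a, b, by rw [h]; ring⟩
  have hw : w ∈ Ideal.span ((fun s => monomial s (1 : K)) '' s) := by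
    rw [mem_ideal_span_monomial_image] at hmem ⊢
    intro m hm
    obtain ⟨t, ht, hle⟩ := hmem (Finsupp.single 2 N + m) (by
      rw [mem_support_iff, X_pow_eq_monomial, coeff_monomial_mul, one_mul]
      exact mem_support_iff.1 hm)
    refine ⟨t, ht, ?_⟩
    rcases ht with rfl | rfl
    · have := hle 0
      simp at this
      simpa using this
    · have := hle 1
      simp at this
      simpa using this
  rw [himg, Ideal.mem_span_pair] at hw
  obtain ⟨c, e, rfl⟩ := hw
  exact ⟨c, e, by ring⟩

end Height

section HilbertFunction

variable {K : Type*} [Field K] {n : ℕ}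

/-- The entries of the middle map of the Buchsbaum–Rim complex are homogeneous. -/
theorem minorMatrix_mem_hcomp (φ : Matrix (Fin n) (Fin (n + 2)) (MvPolynomial (Fin 3) K))
    (a : Fin n → ℤ) (b : Fin (n + 2) → ℤ) (hφ : ∀ i j, φ i j ∈ hcomp K 3 (b j - a i))
    (j k : Fin (n + 2)) :
    minorMatrix φ j k ∈ hcomp K 3 ((∑ j, b j) - ∑ i, a i - b j - b k) := by
  have h := det_mem_hcomp
    ((adjoinRows φ (Pi.single j 1) (Pi.single k 1)).submatrix id finSumFinEquiv)
    (b ∘ finSumFinEquiv) (Sum.elim a ![b j, b k]) (by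
      have hs : ∀ k l : Fin (n + 2), (Pi.single k 1 : Fin (n + 2) → MvPolynomial (Fin 3) K) l
          ∈ hcomp K 3 (b l - b k) := by
        intro k l
        by_cases hkl : l = k
        · subst hkl
          simpa using one_mem_hcomp
        · simp [hkl]
      rintro (i | i) l
      · exact hφ _ _
      · fin_cases i
        · exact hs j _
        · exact hs k _)
  have e1 : ∑ i, (b ∘ finSumFinEquiv) i = ∑ j, b j := Equiv.sum_comp finSumFinEquiv b
  rw [e1, Fintype.sum_sum_type, Fin.sum_univ_two] at h
  simp only [Sum.elim_inl, Sum.elim_inr, Matrix.cons_val_zero, Matrix.cons_val_one] at h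
  rwa [← sub_sub, ← sub_sub] at h

theorem minor_mem_hcomp (φ : Matrix (Fin n) (Fin (n + 2)) (MvPolynomial (Fin 3) K))
    (a : Fin n → ℤ) (b : Fin (n + 2) → ℤ) (hφ : ∀ i j, φ i j ∈ hcomp K 3 (b j - a i))
    (g : Fin n → Fin (n + 2)) : ∃ z, (φ.submatrix id g).det ∈ hcomp K 3 z :=
  ⟨_, det_mem_hcomp _ (b ∘ g) a fun i j => hφ i (g j)⟩

/-- Graded rank-nullity for a homogeneous matrix. -/
theorem finrank_map_add_finrank_map {ι κ μ : Type*} [Fintype ι] [Fintype κ] [Fintype μ]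
    (A : Matrix ι κ (MvPolynomial (Fin 3) K)) (B : Matrix κ μ (MvPolynomial (Fin 3) K))
    (c : κ → ℤ) (d : μ → ℤ) (hB : ∀ i j, B i j ∈ hcomp K 3 (d j - c i))
    (hAB : LinearMap.ker A.mulVecLin = LinearMap.range B.mulVecLin) (t : ℤ) :
    Module.finrank K ((freePiece K c t).map (A.mulVecLin.restrictScalars K))
      + Module.finrank K ((freePiece K d t).map (B.mulVecLin.restrictScalars K))
      = ∑ i, Module.finrank K (hcomp K 3 (t - c i)) := by
  rw [← finrank_freePiece, ← freePiece_inf_range B c d hB, ← hAB]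
  exact finrank_map_add_finrank_inf_ker (A.mulVecLin.restrictScalars K) (freePiece K c t)

theorem finrank_cokerPiece_add {m : ℕ} (φ : Matrix (Fin n) (Fin m) (MvPolynomial (Fin 3) K))
    (a : Fin n → ℤ) (b : Fin m → ℤ) (hφ : ∀ i j, φ i j ∈ hcomp K 3 (b j - a i)) (t : ℤ) :
    Module.finrank K (cokerPiece φ a t)
      + Module.finrank K ((freePiece K b t).map (φ.mulVecLin.restrictScalars K))
      = ∑ i, Module.finrank K (hcomp K 3 (t - a i)) := by
  have hker : LinearMap.ker ((LinearMap.range φ.mulVecLin).mkQ.restrictScalars K)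
      = (LinearMap.range φ.mulVecLin).restrictScalars K := by
    ext v
    simp
  rw [← finrank_freePiece, ← freePiece_inf_range φ a b hφ, ← hker]
  exact finrank_map_add_finrank_inf_ker _ (freePiece K a t)

/-- The Hilbert function of the cokernel, computed from the Buchsbaum–Rim resolution. -/
theorem finrank_cokerPiece (φ : Matrix (Fin n) (Fin (n + 2)) (MvPolynomial (Fin 3) K))
    (a : Fin n → ℤ) (b : Fin (n + 2) → ℤ) (hφ : ∀ i j, φ i j ∈ hcomp K 3 (b j - a i))
    (h₃ : ∀ v, φ.transpose.mulVec v = 0 → v = 0)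
    (h₂ : ∀ v, (minorMatrix φ).mulVec v = 0 → ∃ w, φ.transpose.mulVec w = v)
    (h₁ : ∀ v, φ.mulVec v = 0 → ∃ w, (minorMatrix φ).mulVec w = v)
    (d : ℤ) (hd : d = (∑ j, b j) - ∑ i, a i) (t : ℤ) :
    (Module.finrank K (cokerPiece φ a t) : ℤ)
      = ∑ i, (Module.finrank K (hcomp K 3 (t - a i)) : ℤ)
        - ∑ j, (Module.finrank K (hcomp K 3 (t - b j)) : ℤ)
        + ∑ j, (Module.finrank K (hcomp K 3 (t - (d - b j))) : ℤ)
        - ∑ i, (Module.finrank K (hcomp K 3 (t - (d - a i))) : ℤ) := by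
  have e₀ := finrank_cokerPiece_add φ a b hφ t
  have e₁ := finrank_map_add_finrank_map φ (minorMatrix φ) b (fun j => d - b j)
    (fun j k => by
      have := minorMatrix_mem_hcomp φ a b hφ j k
      rwa [← hd, show d - b j - b k = d - b k - b j by ring] at this)
    (by
      ext v
      refine ⟨fun hv => h₁ v hv, ?_⟩
      rintro ⟨w, rfl⟩
      rw [LinearMap.mem_ker, Matrix.mulVecLin_apply, Matrix.mulVecLin_apply, Matrix.mulVec_mulVec,
        mul_minorMatrix, Matrix.zero_mulVec]) t
  have e₂ := finrank_map_add_finrank_map (minorMatrix φ) φ.transpose (fun j => d - b j)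
    (fun i => d - a i)
    (fun j i => by
      rw [show d - a i - (d - b j) = b j - a i by ring]
      exact hφ i j)
    (by
      ext v
      refine ⟨fun hv => h₂ v hv, ?_⟩
      rintro ⟨w, rfl⟩
      rw [LinearMap.mem_ker, Matrix.mulVecLin_apply, Matrix.mulVecLin_apply, Matrix.mulVec_mulVec,
        minorMatrix_mul_transpose, Matrix.zero_mulVec]) t
  have e₃ := finrank_freePiece (K := K) (fun i => d - a i) t
  rw [← finrank_map_add_finrank_inf_ker (φ.transpose.mulVecLin.restrictScalars K)] at e₃
  have hker : LinearMap.ker (φ.transpose.mulVecLin.restrictScalars K) = ⊥ :=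
    LinearMap.ker_eq_bot'.2 h₃
  rw [hker, inf_bot_eq, finrank_bot, add_zero] at e₃
  push_cast [← Nat.cast_sum]
  lia

end HilbertFunction

/-- If `a₁ = 0` and `K` has characteristic not two, then the Hilbert
function of `M = coker φ` is symmetric: `h_M(t) = h_M(d - 3 - t)` for all `t`,
where `d = ∑ b j - ∑ a i`. -/
theorem stmt7 {K : Type*} [Field K] [IsAlgClosed K] (hchar : ringChar K ≠ 2)
    (n : ℕ) (hn : 0 < n) (a : Fin n → ℤ) (b : Fin (n + 2) → ℤ)
    (ha : Monotone a) (hb : Monotone b)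
    (φ : Matrix (Fin n) (Fin (n + 2)) (MvPolynomial (Fin 3) K))
    (hφ : ∀ i j, φ i j = 0 ∨
      (0 < b j - a i ∧ (φ i j).IsHomogeneous (b j - a i).toNat))
    (I : Ideal (MvPolynomial (Fin 3) K))
    (hI : I = Ideal.span {m | ∃ g : Fin n → Fin (n + 2),
        Function.Injective g ∧ m = (φ.submatrix id g).det})
    (hht : idealHeight I = 3)
    (ha1 : a ⟨0, hn⟩ = 0)
    (d : ℤ) (hd : d = (∑ j, b j) - ∑ i, a i) :
    ∀ t : ℤ, Module.finrank K (cokerPiece φ a t)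
      = Module.finrank K (cokerPiece φ a (d - 3 - t)) := by
  have hφ' : ∀ i j, φ i j ∈ hcomp K 3 (b j - a i) := fun i j =>
    mem_hcomp_iff.2 ((hφ i j).imp id fun h => ⟨h.1.le, h.2⟩)
  obtain ⟨N, hN⟩ := exists_X_pow_mem _ (by
    rintro f ⟨g, -, rfl⟩
    exact minor_mem_hcomp φ a b hφ' g) (hI ▸ hht)
  have hN' : ∀ s ∈ ({X 0 ^ N, X 1 ^ N, X 2 ^ N} : Set (MvPolynomial (Fin 3) K)), _ :=
    fun s hs => minorIdeal_annihilates φ s (by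
      rcases hs with rfl | rfl | rfl
      exacts [hN 0, hN 1, hN 2])
  obtain ⟨h₃, h₂, h₁⟩ := exact_of_smul_exact φ.transpose.mulVecLin (minorMatrix φ).mulVecLin
    φ.mulVecLin (fun v => by
      rw [Matrix.mulVecLin_apply, Matrix.mulVecLin_apply, Matrix.mulVec_mulVec,
        minorMatrix_mul_transpose, Matrix.zero_mulVec])
    (X 0 ^ N) (X 1 ^ N) (X 2 ^ N)
    (fun p hp => (mul_eq_zero.1 hp).resolve_left (pow_ne_zero _ (X_ne_zero _)))
    (X_pow_dvd_of_mul_eq N) (mem_span_X_pow_of_mul N)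
    (fun s hs => (hN' s hs).1) (fun s hs => (hN' s hs).2.1) (fun s hs => (hN' s hs).2.2)
  intro t
  have hformula := finrank_cokerPiece φ a b hφ' h₃ h₂ h₁ d hd
  have hdual : ∀ s : ℤ, 2 * (Module.finrank K (hcomp K 3 s) : ℤ)
      = (s + 1) * (s + 2) - 2 * Module.finrank K (hcomp K 3 (-3 - s)) := fun s => by
    linarith [finrank_hcomp_add (K := K) s]
  have key : 2 * (Module.finrank K (cokerPiece φ a t) : ℤ)
      = 2 * Module.finrank K (cokerPiece φ a (d - 3 - t)) := by
    rw [hformula t, hformula (d - 3 - t)]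
    simp only [mul_add, mul_sub, Finset.mul_sum]
    have hsub : ∀ c : ℤ, 2 * (Module.finrank K (hcomp K 3 (t - c)) : ℤ)
        = (t - c + 1) * (t - c + 2) - 2 * Module.finrank K (hcomp K 3 (d - 3 - t - (d - c))) :=
      fun c => by rw [hdual, show -3 - (t - c) = d - 3 - t - (d - c) by ring]
    have hsub' : ∀ c : ℤ, 2 * (Module.finrank K (hcomp K 3 (t - (d - c))) : ℤ)
        = (t - (d - c) + 1) * (t - (d - c) + 2)
          - 2 * Module.finrank K (hcomp K 3 (d - 3 - t - c)) :=
      fun c => by rw [hdual, show -3 - (t - (d - c)) = d - 3 - t - c by ring]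
    simp only [fun i => hsub (a i), fun j => hsub (b j), fun i => hsub' (a i),
      fun j => hsub' (b j), Finset.sum_sub_distrib]
    have hpoly : ∑ i, (t - a i + 1) * (t - a i + 2) - ∑ j, (t - b j + 1) * (t - b j + 2)
        + ∑ j, (t - (d - b j) + 1) * (t - (d - b j) + 2)
        - ∑ i, (t - (d - a i) + 1) * (t - (d - a i) + 2) = 0 := by
      have diff : ∀ (m : ℕ) (c : Fin m → ℤ), ∑ i, (t - c i + 1) * (t - c i + 2)
          - ∑ i, (t - (d - c i) + 1) * (t - (d - c i) + 2)
          = m * (d * (2 * t + 3 - d)) - 2 * (2 * t + 3 - d) * ∑ i, c i := by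
        intro m c
        rw [← Finset.sum_sub_distrib, Finset.mul_sum, ← nsmul_eq_mul, ← Fin.sum_const,
          ← Finset.sum_sub_distrib]
        exact Finset.sum_congr rfl fun i _ => by ring
      have ea := diff n a
      have eb := diff (n + 2) b
      push_cast at eb
      linear_combination ea - eb - 2 * (2 * t + 3 - d) * hd
    linarith
  have := mul_left_cancel₀ two_ne_zero key
  exact_mod_cast this
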